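/- Fix v and a constant σ > 0 with Λσ² ≤ 3/2. Suppose on the segment [u₁,u₂]×{v} ⊆ D one has ∂_u r < 0 and μ > 1 (so that the trapped-region inequality ∂_u m ≥ (Λ/2) r² ∂_u r holds by the mass equation), and suppose r(u₁,v) = σ and 2m(u₁,v) > σ. Then for every u ∈ [u₁,u₂] with r(u,v) ≤ σ one has 2m(u,v) ≥ σ/2; in particular the mass ratio satisfies μ(u,v) ≥ σ/(2 r(u,v)). -/

import Mathlib

open Real Filter Set

/-- Partial derivative in the first (u) coordinate. -/
noncomputable def pdu (f : ℝ × ℝ → ℝ) (z : ℝ × ℝ) : ℝ :=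
  deriv (fun x => f (x, z.2)) z.1

/-- Partial derivative in the second (v) coordinate. -/
noncomputable def pdv (f : ℝ × ℝ → ℝ) (z : ℝ × ℝ) : ℝ :=
  deriv (fun y => f (z.1, y)) z.2

/-- The slice `x ↦ (x, c)` composed with a differentiable function is differentiable. -/
theorem differentiableAt_slice_fst {f : ℝ × ℝ → ℝ} {z : ℝ × ℝ} (hf : DifferentiableAt ℝ f z) :
    DifferentiableAt ℝ (fun x => f (x, z.2)) z.1 :=
  DifferentiableAt.comp (f := fun x : ℝ => (x, z.2)) z.1 hf (by fun_prop)

theorem hasDerivAt_pdu {f : ℝ × ℝ → ℝ} {z : ℝ × ℝ} (hf : DifferentiableAt ℝ f z) :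
    HasDerivAt (fun x => f (x, z.2)) (pdu f z) z.1 :=
  (differentiableAt_slice_fst hf).hasDerivAt

theorem pdu_eq_fderiv {f : ℝ × ℝ → ℝ} {z : ℝ × ℝ} (hf : DifferentiableAt ℝ f z) :
    pdu f z = fderiv ℝ f z (1, 0) :=
  (HasFDerivAt.comp_hasDerivAt (f := fun x : ℝ => (x, z.2)) z.1 hf.hasFDerivAt
    ((hasDerivAt_id z.1).prodMk (hasDerivAt_const z.1 z.2))).deriv

theorem pdv_eq_fderiv {f : ℝ × ℝ → ℝ} {z : ℝ × ℝ} (hf : DifferentiableAt ℝ f z) :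
    pdv f z = fderiv ℝ f z (0, 1) :=
  (HasFDerivAt.comp_hasDerivAt (f := fun y : ℝ => (z.1, y)) z.2 hf.hasFDerivAt
    ((hasDerivAt_const z.2 z.1).prodMk (hasDerivAt_id z.2))).deriv

theorem differentiableAt_fderiv_apply {f : ℝ × ℝ → ℝ} {z : ℝ × ℝ} (hf : ContDiffAt ℝ 2 f z)
    (w : ℝ × ℝ) : DifferentiableAt ℝ (fun y => fderiv ℝ f y w) z :=
  ((hf.fderiv_right (m := 1) (by norm_num)).differentiableAt (by norm_num)).clm_apply
    (differentiableAt_const w)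

theorem differentiableAt_pdu {f : ℝ × ℝ → ℝ} {z : ℝ × ℝ} (hf : ContDiffAt ℝ 2 f z) :
    DifferentiableAt ℝ (pdu f) z := by
  refine (differentiableAt_fderiv_apply hf (1, 0)).congr_of_eventuallyEq ?_
  filter_upwards [hf.eventually (by norm_num)] with y hy
  exact pdu_eq_fderiv (hy.differentiableAt (by norm_num))

theorem differentiableAt_pdv {f : ℝ × ℝ → ℝ} {z : ℝ × ℝ} (hf : ContDiffAt ℝ 2 f z) :
    DifferentiableAt ℝ (pdv f) z := by
  refine (differentiableAt_fderiv_apply hf (0, 1)).congr_of_eventuallyEq ?_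
  filter_upwards [hf.eventually (by norm_num)] with y hy
  exact pdv_eq_fderiv (hy.differentiableAt (by norm_num))

/-- The mass equation in the `u` direction, for `2 m`. -/
theorem hasDerivAt_two_mul_mass {Λ : ℝ} {r Ω φ : ℝ × ℝ → ℝ} {z : ℝ × ℝ}
    (hr : ContDiffAt ℝ 2 r z) (hΩ : DifferentiableAt ℝ Ω z) (hΩz : Ω z ≠ 0)
    (hB : pdu (fun w => r w * pdv r w) z = -(1/4) * Ω z ^ 2 * (1 - Λ * r z ^ 2))
    (hA : pdu (fun w => (Ω w ^ 2)⁻¹ * pdu r w) z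
      = -(r z) * (Ω z ^ 2)⁻¹ * (pdu φ z) ^ 2) :
    HasDerivAt (fun x => 2 * (r (x, z.2) / 2 *
        (1 + 4 * (Ω (x, z.2) ^ 2)⁻¹ * pdu r (x, z.2) * pdv r (x, z.2))))
      (Λ * r z ^ 2 * pdu r z - 4 * r z ^ 2 * (Ω z ^ 2)⁻¹ * pdu φ z ^ 2 * pdv r z) z.1 := by
  have hrd : DifferentiableAt ℝ r z := hr.differentiableAt (by norm_num)
  have hAd := hasDerivAt_pdu (((hΩ.pow 2).inv (pow_ne_zero 2 hΩz)).mul (differentiableAt_pdu hr))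
  have hBd := hasDerivAt_pdu (hrd.mul (differentiableAt_pdv hr))
  have key := (hasDerivAt_pdu hrd).add ((hAd.mul hBd).const_mul 4)
  have eA : pdu ((Ω ^ 2)⁻¹ * pdu r) z = -(r z) * (Ω z ^ 2)⁻¹ * (pdu φ z) ^ 2 := hA
  have eB : pdu (r * pdv r) z = -(1/4) * Ω z ^ 2 * (1 - Λ * r z ^ 2) := hB
  rw [eA, eB] at key
  refine (key.congr_deriv ?_).congr_of_eventuallyEq (Eventually.of_forall fun x => ?_)
  · simp only [Pi.mul_apply, Pi.inv_apply, Pi.pow_apply, Prod.mk.eta]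
    field_simp
    ring
  · simp only [Pi.add_apply, Pi.mul_apply, Pi.inv_apply, Pi.pow_apply]
    ring

theorem trapped_region_mass_lower_bound
    (Λ : ℝ) (hΛ : 0 < Λ) (D : Set (ℝ × ℝ)) (hD : IsOpen D)
    (r Ω φ : ℝ × ℝ → ℝ)
    (hrC : ContDiffOn ℝ (⊤ : ℕ∞) r D) (hΩC : ContDiffOn ℝ (⊤ : ℕ∞) Ω D) (hφC : ContDiffOn ℝ (⊤ : ℕ∞) φ D)
    (hrpos : ∀ z ∈ D, 0 < r z) (hΩpos : ∀ z ∈ D, 0 < Ω z)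
    (hsys1 : ∀ z ∈ D, pdu (fun w => r w * pdv r w) z = -(1/4) * Ω z ^ 2 * (1 - Λ * r z ^ 2))
    (hsys2 : ∀ z ∈ D, pdv (fun w => r w * pdu r w) z = -(1/4) * Ω z ^ 2 * (1 - Λ * r z ^ 2))
    (hsys3 : ∀ z ∈ D, pdu (pdv (fun w => Real.log (Ω w ^ 2))) z =
      -2 * pdu φ z * pdv φ z + (1/2) * (r z)⁻¹ ^ 2 * Ω z ^ 2
        + 2 * (r z)⁻¹ ^ 2 * pdu r z * pdv r z)
    (hsys4 : ∀ z ∈ D, r z * pdu (pdv φ) z = -(pdu r z) * pdv φ z - pdv r z * pdu φ z)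
    (hsys5 : ∀ z ∈ D, pdu (fun w => (Ω w ^ 2)⁻¹ * pdu r w) z
      = -(r z) * (Ω z ^ 2)⁻¹ * (pdu φ z) ^ 2)
    (hsys6 : ∀ z ∈ D, pdv (fun w => (Ω w ^ 2)⁻¹ * pdv r w) z
      = -(r z) * (Ω z ^ 2)⁻¹ * (pdv φ z) ^ 2)
    (m μ : ℝ × ℝ → ℝ)
    (hm : m = fun w => r w / 2 * (1 + 4 * (Ω w ^ 2)⁻¹ * pdu r w * pdv r w))
    (hμ : μ = fun w => 2 * m w / r w)
    (v σ u₁ u₂ : ℝ) (hσ : 0 < σ) (hΛσ : Λ * σ ^ 2 ≤ 3 / 2)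
    (hseg : ∀ u ∈ Set.Icc u₁ u₂, (u, v) ∈ D)
    (hdur : ∀ u ∈ Set.Icc u₁ u₂, pdu r (u, v) < 0)
    (hmu : ∀ u ∈ Set.Icc u₁ u₂, 1 < μ (u, v))
    (hr1 : r (u₁, v) = σ) (hm1 : σ < 2 * m (u₁, v)) :
    ∀ u ∈ Set.Icc u₁ u₂, r (u, v) ≤ σ →
      σ / 2 ≤ 2 * m (u, v) ∧ σ / (2 * r (u, v)) ≤ μ (u, v) := by
  have hmono : MonotoneOn (fun x => 2 * m (x, v) - Λ / 3 * r (x, v) ^ 3) (Set.Icc u₁ u₂) := by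
    have hder : ∀ x ∈ Set.Icc u₁ u₂, ∃ d, 0 ≤ d ∧
        HasDerivAt (fun x => 2 * m (x, v) - Λ / 3 * r (x, v) ^ 3) d x := by
      intro x hx
      have hz := hseg x hx
      have hr0 := hrpos _ hz
      have hΩ0 := hΩpos _ hz
      have hrc : ContDiffAt ℝ 2 r (x, v) :=
        contDiffAt_infty.1 (hrC.contDiffAt (hD.mem_nhds hz)) 2
      have hΩd : DifferentiableAt ℝ Ω (x, v) :=
        (hΩC.contDiffAt (hD.mem_nhds hz)).differentiableAt (by simp)
      have hrv : pdv r (x, v) < 0 := by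
        have h := hmu x hx
        simp only [hμ, hm] at h
        rw [lt_div_iff₀ hr0] at h
        have h1 : 0 < (4 * r (x, v) * (Ω (x, v) ^ 2)⁻¹) * (pdu r (x, v) * pdv r (x, v)) := by
          linarith
        have h2 := (mul_pos_iff_of_pos_left (by positivity)).1 h1
        exact neg_of_mul_pos_right h2 (hdur x hx).le
      have hmass := hasDerivAt_two_mul_mass (φ := φ) hrc hΩd hΩ0.ne' (hsys1 _ hz) (hsys5 _ hz)
      have hru := hasDerivAt_pdu (hrc.differentiableAt (by norm_num))
      refine ⟨4 * r (x, v) ^ 2 * (Ω (x, v) ^ 2)⁻¹ * pdu φ (x, v) ^ 2 * -pdv r (x, v),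
        mul_nonneg (by positivity) (by linarith), ?_⟩
      rw [hm]
      refine (hmass.sub ((hru.pow 3).const_mul (Λ / 3))).congr_deriv ?_
      norm_num
      ring
    choose! d hd0 hd using hder
    refine monotoneOn_of_hasDerivWithinAt_nonneg (convex_Icc u₁ u₂)
      (fun x hx => (hd x hx).continuousAt.continuousWithinAt)
      (fun x hx => (hd x (interior_subset hx)).hasDerivWithinAt)
      (fun x hx => hd0 x (interior_subset hx))
  intro u hu _
  have hr0 := hrpos _ (hseg u hu)
  have hle := hmono (left_mem_Icc.2 (hu.1.trans hu.2)) hu hu.1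
  simp only [hr1] at hle
  have hcube : 0 ≤ Λ / 3 * r (u, v) ^ 3 := by positivity
  have hσ3 : Λ / 3 * σ ^ 3 ≤ σ / 2 := by nlinarith
  have hbound : σ / 2 ≤ 2 * m (u, v) := by linarith
  refine ⟨hbound, ?_⟩
  simp only [hμ]
  rw [← div_div]
  gcongr
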